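/- Let n ≥ 4 be even and let t be an integer with t > 1. Let j be minimal such that 0 ≤ j ≤ n/2 and gcd(n/2 − j, t) = 1. Then among the degrees d_1,…,d_{n−2} of any hsop of I_n, at least ⌊(n−j)/t⌋ are divisible by t. -/

import Mathlib

set_option synthInstance.maxHeartbeats 1000000
noncomputable section

open MvPolynomial

/-- The binary form of degree `n` with coefficient vector `a`, as a polynomial in two
variables `X 0 = x`, `X 1 = y`. -/
def formPoly (n : ℕ) (a : Fin (n+1) → ℂ) : MvPolynomial (Fin 2) ℂ :=
  ∑ i : Fin (n+1), C (a i) * X 0 ^ (n - (i : ℕ)) * X 1 ^ (i : ℕ)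

/-- The action of `SL(2,ℂ)` on coefficient vectors of binary forms of degree `n`,
given by linear substitution of the variables `x`, `y`. -/
def sl2Act (n : ℕ) (g : Matrix.SpecialLinearGroup (Fin 2) ℂ) (a : Fin (n+1) → ℂ) :
    Fin (n+1) → ℂ := fun i =>
  coeff (Finsupp.single 0 (n - (i : ℕ)) + Finsupp.single 1 (i : ℕ))
    (bind₁ (fun j : Fin 2 => C (g.1 j 0) * X 0 + C (g.1 j 1) * X 1) (formPoly n a))

/-- The ring of invariants `I_n` of the binary form of degree `n`: the subalgebra of
`ℂ[a_0,…,a_n]` of polynomials invariant under the `SL(2,ℂ)`-action. -/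
def invariantRing (n : ℕ) : Subalgebra ℂ (MvPolynomial (Fin (n+1)) ℂ) where
  carrier := {p | ∀ g : Matrix.SpecialLinearGroup (Fin 2) ℂ, ∀ a : Fin (n+1) → ℂ,
    eval (sl2Act n g a) p = eval a p}
  mul_mem' := by
    intro p q hp hq g a
    simp only [Set.mem_setOf_eq, map_mul] at *
    rw [hp g a, hq g a]
  add_mem' := by
    intro p q hp hq g a
    simp only [Set.mem_setOf_eq, map_add] at *
    rw [hp g a, hq g a]
  algebraMap_mem' := by
    intro c g a
    simp

/-- `IsHSOP n d p` says that `p` is a homogeneous system of parameters of the invariant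
ring of the binary form of degree `n`, with degree sequence `d` : the `p k` are
homogeneous of positive degrees `d k`, algebraically independent over `ℂ`, and `I_n` is a
finitely generated module over the subalgebra they generate. -/
def IsHSOP (n : ℕ) (d : Fin (n-2) → ℕ) (p : Fin (n-2) → invariantRing n) : Prop :=
  (∀ k, 0 < d k) ∧
  (∀ k, ((p k : MvPolynomial (Fin (n+1)) ℂ)).IsHomogeneous (d k)) ∧
  AlgebraicIndependent ℂ p ∧
  Module.Finite (Algebra.adjoin ℂ (Set.range p)) (invariantRing n)

/-- The coefficient of `x ^ (n - i) * y ^ i` in the product of the `n` linear forms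
`u a * x + v a * y`. -/
def productCoeff {ι R : Type*} [Fintype ι] [DecidableEq ι] [CommRing R] (u v : ι → R)
    (i : ℕ) : R :=
  ∑ S ∈ Finset.powersetCard i Finset.univ, (∏ a ∈ S, v a) * ∏ a ∈ Finset.univ \ S, u a

section ProductCoeff

variable {ι R R' : Type*} [Fintype ι] [DecidableEq ι] [CommRing R] [CommRing R']

theorem prod_linear_eq_sum_productCoeff {n : ℕ} (hn : Fintype.card ι = n) (u v : ι → R)
    (x y : R) : ∏ a, (u a * x + v a * y) =
      ∑ i : Fin (n + 1), productCoeff u v i * x ^ (n - (i : ℕ)) * y ^ (i : ℕ) := by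
  rw [Fin.sum_univ_eq_sum_range (fun i => productCoeff u v i * x ^ (n - i) * y ^ i)]
  simp_rw [add_comm (u _ * x)]
  rw [Finset.prod_add, Finset.sum_powerset, Finset.card_univ, hn]
  refine Finset.sum_congr rfl fun i _ => ?_
  rw [productCoeff, Finset.sum_mul, Finset.sum_mul]
  refine Finset.sum_congr rfl fun S hS => ?_
  rw [Finset.mem_powersetCard] at hS
  rw [Finset.prod_mul_distrib, Finset.prod_mul_distrib, Finset.prod_const, Finset.prod_const,
    Finset.card_sdiff_of_subset hS.1, hS.2, Finset.card_univ, hn]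
  ring

theorem map_productCoeff {F : Type*} [FunLike F R R'] [RingHomClass F R R'] (f : F)
    (u v : ι → R) (i : ℕ) :
    f (productCoeff u v i) = productCoeff (fun a => f (u a)) (fun a => f (v a)) i := by
  simp [productCoeff, map_sum, map_prod]

theorem productCoeff_eq_coeff {n : ℕ} (hn : Fintype.card ι = n) (u v : ι → R) (i : Fin (n + 1)) :
    productCoeff u v i =
      (∏ a, (Polynomial.C (u a) + Polynomial.C (v a) * Polynomial.X)).coeff i := by
  have h := prod_linear_eq_sum_productCoeff hn (fun a => Polynomial.C (u a))
    (fun a => Polynomial.C (v a)) 1 Polynomial.X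
  simp only [mul_one, one_pow] at h
  rw [h]
  simp_rw [← map_productCoeff]
  rw [Fin.sum_univ_eq_sum_range (fun i => Polynomial.C (productCoeff u v i) * Polynomial.X ^ i),
    Polynomial.finsetSum_coeff]
  simp only [Polynomial.coeff_C_mul, Polynomial.coeff_X_pow, mul_ite, mul_one, mul_zero,
    Finset.sum_ite_eq, Finset.mem_range, i.isLt, if_true]

theorem productCoeff_mul_left (c u v : ι → R) (i : ℕ) :
    productCoeff (fun a => c a * u a) (fun a => c a * v a) i = (∏ a, c a) * productCoeff u v i := by
  rw [productCoeff, productCoeff, Finset.mul_sum]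
  refine Finset.sum_congr rfl fun S _ => ?_
  rw [Finset.prod_mul_distrib, Finset.prod_mul_distrib,
    ← Finset.prod_sdiff (Finset.subset_univ S) (f := c)]
  ring

theorem productCoeff_mul_right (c : R) (u v : ι → R) (i : ℕ) :
    productCoeff u (fun a => c * v a) i = c ^ i * productCoeff u v i := by
  rw [productCoeff, productCoeff, Finset.mul_sum]
  refine Finset.sum_congr rfl fun S hS => ?_
  rw [Finset.prod_mul_distrib, Finset.prod_const, (Finset.mem_powersetCard.1 hS).2]
  ring

theorem productCoeff_comp_perm {n : ℕ} (hn : Fintype.card ι = n) (σ : Equiv.Perm ι) (u v : ι → R)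
    (i : Fin (n + 1)) : productCoeff (u ∘ σ) (v ∘ σ) i = productCoeff u v i := by
  rw [productCoeff_eq_coeff hn, productCoeff_eq_coeff hn]
  congr 1
  exact Equiv.prod_comp σ (fun a => Polynomial.C (u a) + Polynomial.C (v a) * Polynomial.X)

/-- Ryser's formula for the permanent. -/
theorem sum_perm_prod_eq_sum_finset (y : ι → ι → R) :
    ∑ σ : Equiv.Perm ι, ∏ i, y (σ i) i =
      ∑ T : Finset ι, (-1) ^ T.card * ∏ i, ∑ s ∈ Tᶜ, y s i := by
  classical
  have key : ∀ T : Finset ι, ∏ i, ∑ s ∈ Tᶜ, y s i =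
      ∑ f : ι → ι, if T ⊆ (Finset.univ.image f)ᶜ then ∏ i, y (f i) i else 0 := by
    intro T
    rw [Finset.prod_univ_sum, ← Finset.sum_filter]
    refine Finset.sum_congr ?_ fun _ _ => rfl
    ext f
    simp only [Fintype.mem_piFinset, Finset.mem_compl, Finset.mem_filter, Finset.mem_univ,
      true_and, Finset.subset_iff, Finset.mem_image, not_exists]
    constructor
    · intro h x hx i hi
      exact h i (hi ▸ hx)
    · intro h i hi
      exact h hi i rfl
  simp_rw [key, Finset.mul_sum]
  rw [Finset.sum_comm]
  have h2 : ∀ f : ι → ι, (∑ T : Finset ι, (-1 : R) ^ T.card *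
      (if T ⊆ (Finset.univ.image f)ᶜ then ∏ i, y (f i) i else 0)) =
      if Function.Bijective f then ∏ i, y (f i) i else 0 := by
    intro f
    have h3 : (∑ T ∈ ((Finset.univ.image f)ᶜ).powerset, (-1 : R) ^ T.card) =
        if (Finset.univ.image f)ᶜ = ∅ then 1 else 0 := by
      have := congrArg (Int.cast : ℤ → R)
        (Finset.sum_powerset_neg_one_pow_card (x := (Finset.univ.image f)ᶜ))
      push_cast at this
      exact this
    have h4 : (Finset.univ.image f)ᶜ = ∅ ↔ Function.Bijective f := by
      rw [← Finite.surjective_iff_bijective, Finset.compl_eq_empty_iff, Finset.eq_univ_iff_forall]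
      simp [Function.Surjective]
    simp_rw [mul_ite, mul_zero]
    rw [← Finset.sum_filter, ← Finset.sum_mul]
    have h5 : (Finset.univ.filter fun T : Finset ι => T ⊆ (Finset.univ.image f)ᶜ) =
        ((Finset.univ.image f)ᶜ).powerset := by
      ext T; simp
    rw [h5, h3]
    simp only [h4, ite_mul, one_mul, zero_mul]
  simp_rw [h2]
  rw [← Finset.sum_filter]
  refine Finset.sum_bij (fun σ _ => (σ : ι → ι)) ?_ ?_ ?_ ?_
  · intro σ _
    simp
  · intro σ _ τ _ h
    exact DFunLike.coe_injective h
  · intro f hf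
    exact ⟨Equiv.ofBijective f (by simpa using hf), Finset.mem_univ _, rfl⟩
  · intro σ _
    rfl

end ProductCoeff

/-- Every complex univariate polynomial of degree at most `n` is a scalar multiple of a product of
`n` polynomials of degree at most one. -/
theorem exists_eq_C_mul_prod_linear (n : ℕ) (f : Polynomial ℂ) (hf : f.natDegree ≤ n) :
    ∃ (c : ℂ) (u v : Fin n → ℂ),
      f = Polynomial.C c * ∏ a, (Polynomial.C (u a) + Polynomial.C (v a) * Polynomial.X) := by
  induction n generalizing f with
  | zero =>
    refine ⟨f.coeff 0, Fin.elim0, Fin.elim0, ?_⟩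
    simpa using Polynomial.eq_C_of_natDegree_le_zero hf
  | succ n ih =>
    by_cases h : f.natDegree ≤ n
    · obtain ⟨c, u, v, hc⟩ := ih f h
      refine ⟨c, Fin.cons 1 u, Fin.cons 0 v, ?_⟩
      simpa [Fin.prod_univ_succ] using hc
    · have hd : f.degree ≠ 0 := by
        intro h0
        have := Polynomial.natDegree_eq_zero_iff_degree_le_zero.2 h0.le
        omega
      obtain ⟨r, hr⟩ := IsAlgClosed.exists_root f hd
      obtain ⟨q, rfl⟩ := Polynomial.dvd_iff_isRoot.2 hr
      have hq : q ≠ 0 := by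
        rintro rfl
        simp at h
      rw [Polynomial.natDegree_mul (Polynomial.X_sub_C_ne_zero r) hq,
        Polynomial.natDegree_X_sub_C] at hf
      obtain ⟨c, u, v, hc⟩ := ih q (by omega)
      refine ⟨c, Fin.cons (-r) u, Fin.cons 1 v, ?_⟩
      rw [Fin.prod_univ_succ]
      simp only [Fin.cons_zero, Fin.cons_succ]
      rw [hc]
      simp only [map_neg, map_one]
      ring

theorem exists_productCoeff_eq {ι : Type*} [Fintype ι] [DecidableEq ι] {n : ℕ}
    (hn : Fintype.card ι = n)
    (hpos : 0 < n) (a : Fin (n + 1) → ℂ) :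
    ∃ u v : ι → ℂ, ∀ i : Fin (n + 1), productCoeff u v i = a i := by
  obtain ⟨c, u, v, h⟩ := exists_eq_C_mul_prod_linear n
    (∑ i : Fin (n + 1), Polynomial.C (a i) * Polynomial.X ^ (i : ℕ))
    (Polynomial.natDegree_sum_le_of_forall_le _ _ fun i _ =>
      (Polynomial.natDegree_C_mul_X_pow_le _ _).trans (by omega))
  have e : ι ≃ Fin n := Fintype.equivFinOfCardEq hn
  let z : ι := e.symm ⟨0, hpos⟩
  refine ⟨fun b => (if b = z then c else 1) * u (e b), fun b => (if b = z then c else 1) * v (e b),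
    fun i => ?_⟩
  rw [productCoeff_mul_left (fun b => if b = z then c else 1) (fun b => u (e b)) (fun b => v (e b)),
    Finset.prod_ite_eq' Finset.univ z (fun _ => c), if_pos (Finset.mem_univ z),
    productCoeff_eq_coeff hn,
    Equiv.prod_comp e (fun b => Polynomial.C (u b) + Polynomial.C (v b) * Polynomial.X),
    ← Polynomial.coeff_C_mul, ← h, Polynomial.finsetSum_coeff]
  simp [Polynomial.coeff_X_pow, Fin.val_inj]

theorem formPoly_productCoeff {ι : Type*} [Fintype ι] [DecidableEq ι] {n : ℕ}
    (hn : Fintype.card ι = n) (u v : ι → ℂ) :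
    formPoly n (fun i => productCoeff u v i) = ∏ a, (C (u a) * X 0 + C (v a) * X 1) := by
  rw [prod_linear_eq_sum_productCoeff hn, formPoly]
  simp_rw [← map_productCoeff]

theorem coeff_sum_C_mul_X_pow (n : ℕ) (a : Fin (n + 1) → ℂ) (i : Fin (n + 1)) :
    coeff (Finsupp.single 0 (n - (i : ℕ)) + Finsupp.single 1 (i : ℕ))
      (∑ k : Fin (n + 1), C (a k) * X 0 ^ (n - (k : ℕ)) * X 1 ^ (k : ℕ) : MvPolynomial ℕ ℂ) =
      a i := by
  have h : ∀ k : Fin (n + 1), (C (a k) * X 0 ^ (n - (k : ℕ)) * X 1 ^ (k : ℕ) : MvPolynomial ℕ ℂ)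
      = monomial (Finsupp.single 0 (n - (k : ℕ)) + Finsupp.single 1 (k : ℕ)) (a k) := by
    intro k
    rw [X_pow_eq_monomial, X_pow_eq_monomial, C_mul_monomial, monomial_mul]
    simp
  rw [coeff_sum]
  simp_rw [h, coeff_monomial]
  rw [Finset.sum_eq_single i]
  · simp
  · intro k _ hk
    rw [if_neg]
    intro h
    have := DFunLike.congr_fun h 1
    simp at this
    exact hk (Fin.ext this)
  · simp

theorem sl2Act_productCoeff {ι : Type*} [Fintype ι] [DecidableEq ι] {n : ℕ}
    (hn : Fintype.card ι = n) (g : Matrix.SpecialLinearGroup (Fin 2) ℂ) (u v : ι → ℂ) :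
    sl2Act n g (fun i => productCoeff u v i) = fun i : Fin (n + 1) =>
      productCoeff (fun a => u a * g.1 0 0 + v a * g.1 1 0)
        (fun a => u a * g.1 0 1 + v a * g.1 1 1) i := by
  funext i
  refine Eq.trans ?_ (coeff_sum_C_mul_X_pow n (fun i => productCoeff
    (fun a => u a * g.1 0 0 + v a * g.1 1 0) (fun a => u a * g.1 0 1 + v a * g.1 1 1) i) i)
  refine congrArg (MvPolynomial.coeff _) ?_
  simp_rw [map_productCoeff]
  rw [← prod_linear_eq_sum_productCoeff hn, formPoly_productCoeff hn, map_prod]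
  refine Finset.prod_congr rfl fun a _ => ?_
  simp only [map_add, map_mul, bind₁_X_right, bind₁_C_right]
  ring

theorem aeval_productCoeff_of_mem_invariantRing {ι : Type*} [Fintype ι] [DecidableEq ι] {n : ℕ}
    (hn : Fintype.card ι = n) {h : MvPolynomial (Fin (n + 1)) ℂ} (hh : h ∈ invariantRing n)
    {R : Type*} [CommRing R] [Algebra ℂ R] (g : Matrix.SpecialLinearGroup (Fin 2) ℂ) (u v : ι → R) :
    aeval (fun i : Fin (n + 1) => productCoeff
        (fun a => u a * algebraMap ℂ R (g.1 0 0) + v a * algebraMap ℂ R (g.1 1 0))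
        (fun a => u a * algebraMap ℂ R (g.1 0 1) + v a * algebraMap ℂ R (g.1 1 1)) i) h =
      aeval (fun i : Fin (n + 1) => productCoeff u v i) h := by
  have key : aeval (fun i : Fin (n + 1) => productCoeff
        (fun a : ι => X (Sum.inl a) * C (g.1 0 0) + X (Sum.inr a) * C (g.1 1 0))
        (fun a : ι => X (Sum.inl a) * C (g.1 0 1) + X (Sum.inr a) * C (g.1 1 1)) i) h =
      aeval (fun i : Fin (n + 1) => productCoeff (R := MvPolynomial (ι ⊕ ι) ℂ)
        (fun a : ι => X (Sum.inl a)) (fun a : ι => X (Sum.inr a)) i) h := by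
    refine MvPolynomial.funext fun x => ?_
    simp only [← aeval_eq_eval, comp_aeval_apply, map_productCoeff, map_add, map_mul, aeval_X,
      algHom_C]
    have := hh g (fun i => productCoeff (fun a => x (Sum.inl a)) (fun a => x (Sum.inr a)) i)
    rw [sl2Act_productCoeff hn] at this
    simpa [aeval_eq_eval] using this
  have := congrArg (aeval (Sum.elim u v)) key
  simpa only [comp_aeval_apply, map_productCoeff, map_add, map_mul, aeval_X, algHom_C,
    Sum.elim_inl, Sum.elim_inr] using this

section Range

variable {ι : Type*} [Fintype ι] [DecidableEq ι] {n : ℕ} {R : Type*} [CommRing R] [Algebra ℂ R]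

theorem prod_eval_form_mem_range (hn : Fintype.card ι = n) (u v : ι → R) (e : ℕ)
    (b : Fin (e + 1) → ℂ) :
    ∏ i, ∑ k : Fin (e + 1), algebraMap ℂ R (b k) * u i ^ (e - (k : ℕ)) * v i ^ (k : ℕ) ∈
      (aeval (R := ℂ) (fun i : Fin (n + 1) => productCoeff u v i)).range := by
  rcases Nat.eq_zero_or_pos e with rfl | he
  · refine Subalgebra.prod_mem _ fun i _ => ?_
    simp
  · obtain ⟨p, q, hpq⟩ := exists_productCoeff_eq (Fintype.card_fin e) he b
    have h1 : ∀ i, ∑ k : Fin (e + 1), algebraMap ℂ R (b k) * u i ^ (e - (k : ℕ)) * v i ^ (k : ℕ) =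
        ∏ m, (u i * algebraMap ℂ R (p m) + v i * algebraMap ℂ R (q m)) := by
      intro i
      simp_rw [← hpq, map_productCoeff]
      rw [← prod_linear_eq_sum_productCoeff (Fintype.card_fin e)]
      simp_rw [mul_comm]
    simp_rw [h1]
    rw [Finset.prod_comm]
    refine Subalgebra.prod_mem _ fun m _ => ?_
    rw [prod_linear_eq_sum_productCoeff hn]
    refine Subalgebra.sum_mem _ fun i _ => ?_
    refine mul_mem (mul_mem ⟨X i, by simp⟩ ?_) ?_ <;>
    exact pow_mem (Subalgebra.algebraMap_mem _ _) _

theorem sum_perm_prod_mem_range (hn : Fintype.card ι = n) (u v : ι → R) (e : ℕ)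
    (α : ι → Fin (e + 1)) :
    ∑ σ : Equiv.Perm ι, ∏ i, u i ^ (e - (α (σ i) : ℕ)) * v i ^ (α (σ i) : ℕ) ∈
      (aeval (R := ℂ) (fun i : Fin (n + 1) => productCoeff u v i)).range := by
  rw [sum_perm_prod_eq_sum_finset (fun s i => u i ^ (e - (α s : ℕ)) * v i ^ (α s : ℕ))]
  refine Subalgebra.sum_mem _ fun T _ => ?_
  refine mul_mem (pow_mem (neg_mem (one_mem _)) _) ?_
  convert prod_eval_form_mem_range hn u v e
    (fun k => ((Finset.filter (fun s => α s = k) Tᶜ).card : ℂ)) using 1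
  refine Finset.prod_congr rfl fun i _ => ?_
  rw [← Finset.sum_fiberwise (s := Tᶜ) (g := α)]
  refine Finset.sum_congr rfl fun k _ => ?_
  rw [Finset.sum_congr rfl (g := fun _ => u i ^ (e - (k : ℕ)) * v i ^ (k : ℕ))
    (fun s hs => by rw [(Finset.mem_filter.1 hs).2])]
  simp [mul_assoc]

/-- The symmetrization of a multihomogeneous polynomial of multidegree `(e, …, e)` in the
coordinates of linear forms is a polynomial in the coefficients of their product. -/
theorem sum_perm_aeval_mem_range (hn : Fintype.card ι = n) (u v : ι → R) (e : ℕ)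
    (P : MvPolynomial (ι ⊕ ι) ℂ)
    (hP : P.IsWeightedHomogeneous
      (Sum.elim (fun i => Pi.single i 1) (fun i => Pi.single i 1) : ι ⊕ ι → ι → ℕ) (fun _ => e)) :
    ∑ σ : Equiv.Perm ι, aeval (Sum.elim (u ∘ σ) (v ∘ σ)) P ∈
      (aeval (R := ℂ) (fun i : Fin (n + 1) => productCoeff u v i)).range := by
  simp_rw [aeval_def, eval₂_eq']
  rw [Finset.sum_comm]
  refine Subalgebra.sum_mem _ fun d hd => ?_
  rw [← Finset.mul_sum]
  refine mul_mem (Subalgebra.algebraMap_mem _ _) ?_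
  have hde : ∀ i, d (Sum.inl i) + d (Sum.inr i) = e := by
    intro i
    have := congrFun (hP (mem_support_iff.1 hd)) i
    rw [Finsupp.weight_apply, Finsupp.sum_fintype _ _ (by simp)] at this
    simpa [Fintype.sum_sum_type, Finset.sum_apply, Pi.single_apply] using this
  convert sum_perm_prod_mem_range hn u v e
    (fun i => ⟨d (Sum.inr i), by have := hde i; omega⟩) using 1
  rw [← Equiv.sum_comp (Equiv.inv (Equiv.Perm ι))]
  refine Finset.sum_congr rfl fun σ _ => ?_
  rw [Fintype.prod_sum_type, ← Finset.prod_mul_distrib, ← Equiv.prod_comp σ]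
  refine Finset.prod_congr rfl fun i _ => ?_
  have : e - d (Sum.inr (σ i)) = d (Sum.inl (σ i)) := by
    have := hde (σ i); omega
  simp [this]

end Range

/-- The monomial in the brackets `u a * v b - u b * v a` with exponents `w a b`. -/
def bracketMonomial {ι R : Type*} [Fintype ι] [CommRing R] (w : ι → ι → ℕ) (u v : ι → R) : R :=
  ∏ a, ∏ b, (u a * v b - u b * v a) ^ w a b

section BracketMonomial

variable {ι R R' : Type*} [Fintype ι] [CommRing R] [CommRing R']

theorem map_bracketMonomial {F : Type*} [FunLike F R R'] [RingHomClass F R R'] (f : F)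
    (w : ι → ι → ℕ) (u v : ι → R) :
    f (bracketMonomial w u v) = bracketMonomial w (fun a => f (u a)) (fun a => f (v a)) := by
  simp [bracketMonomial, map_prod]

theorem bracketMonomial_add (w w' : ι → ι → ℕ) (u v : ι → R) :
    bracketMonomial (w + w') u v = bracketMonomial w u v * bracketMonomial w' u v := by
  simp [bracketMonomial, pow_add, Finset.prod_mul_distrib]

theorem bracketMonomial_nsmul (k : ℕ) (w : ι → ι → ℕ) (u v : ι → R) :
    bracketMonomial (k • w) u v = bracketMonomial w u v ^ k := by
  simp [bracketMonomial, mul_comm k, pow_mul, Finset.prod_pow]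

theorem bracketMonomial_single [DecidableEq ι] (a b : ι) (u v : ι → R) :
    bracketMonomial (Pi.single a (Pi.single b 1)) u v = u a * v b - u b * v a := by
  rw [bracketMonomial, Finset.prod_eq_single a, Finset.prod_eq_single b]
  · simp
  · intro c _ hc
    simp [hc]
  · simp
  · intro c _ hc
    simp [hc]
  · simp

theorem bracketMonomial_mul_left (c : R) (w : ι → ι → ℕ) (u v : ι → R) :
    bracketMonomial w (fun a => c * u a) (fun a => c * v a) =
      c ^ (2 * ∑ a, ∑ b, w a b) * bracketMonomial w u v := by
  have : ∀ a b, (c * u a) * (c * v b) - (c * u b) * (c * v a) = c ^ 2 * (u a * v b - u b * v a) := by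
    intro a b; ring
  simp_rw [bracketMonomial, this, mul_pow, Finset.prod_mul_distrib, Finset.prod_pow_eq_pow_sum]
  rw [pow_mul]

theorem bracketMonomial_linear (g : Matrix (Fin 2) (Fin 2) R) (hg : g.det = 1)
    (w : ι → ι → ℕ) (u v : ι → R) :
    bracketMonomial w (fun a => u a * g 0 0 + v a * g 1 0) (fun a => u a * g 0 1 + v a * g 1 1) =
      bracketMonomial w u v := by
  rw [Matrix.det_fin_two] at hg
  refine Finset.prod_congr rfl fun a _ => Finset.prod_congr rfl fun b _ => ?_
  congr 1
  linear_combination (u a * v b - u b * v a) * hg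

/-- The exponent matrix `w` is regular of degree `e`: every index occurs `e` times. -/
def IsRegularExponent (w : ι → ι → ℕ) (e : ℕ) : Prop :=
  ∀ i, ∑ b, (w i b + w b i) = e

theorem IsRegularExponent.nsmul {w : ι → ι → ℕ} {e : ℕ} (hw : IsRegularExponent w e) (k : ℕ) :
    IsRegularExponent (k • w) (k * e) := by
  intro i
  rw [← hw i, Finset.mul_sum]
  simp [mul_add]

theorem IsRegularExponent.isWeightedHomogeneous [DecidableEq ι] {w : ι → ι → ℕ} {e : ℕ}
    (hw : IsRegularExponent w e) :
    (bracketMonomial w (fun a => X (Sum.inl a)) (fun a => X (Sum.inr a)) :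
      MvPolynomial (ι ⊕ ι) ℂ).IsWeightedHomogeneous
      (Sum.elim (fun i => Pi.single i 1) (fun i => Pi.single i 1) : ι ⊕ ι → ι → ℕ)
      (fun _ => e) := by
  have hbr : ∀ a b : ι, (X (Sum.inl a) * X (Sum.inr b) - X (Sum.inl b) * X (Sum.inr a) :
      MvPolynomial (ι ⊕ ι) ℂ).IsWeightedHomogeneous
      (Sum.elim (fun i => Pi.single i 1) (fun i => Pi.single i 1) : ι ⊕ ι → ι → ℕ)
      (Pi.single a 1 + Pi.single b 1) := by
    intro a b
    refine IsWeightedHomogeneous.sub ?_ ?_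
    · exact (isWeightedHomogeneous_X ℂ _ (Sum.inl a)).mul (isWeightedHomogeneous_X ℂ _ (Sum.inr b))
    · rw [add_comm]
      exact (isWeightedHomogeneous_X ℂ _ (Sum.inl b)).mul (isWeightedHomogeneous_X ℂ _ (Sum.inr a))
  rw [bracketMonomial]
  have := IsWeightedHomogeneous.prod Finset.univ _ _ fun a _ =>
    IsWeightedHomogeneous.prod Finset.univ _ _ fun b _ => (hbr a b).pow (w a b)
  convert this using 1
  ext i
  rw [← hw i]
  simp [Finset.sum_apply, Pi.single_apply, Finset.sum_add_distrib]

/-- The symmetrization of a regular bracket monomial is an invariant. -/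
theorem IsRegularExponent.exists_invariant [DecidableEq ι] {n : ℕ} (hn : Fintype.card ι = n)
    (hpos : 0 < n) {w : ι → ι → ℕ} {e : ℕ} (hw : IsRegularExponent w e) :
    ∃ h ∈ invariantRing n, ∀ {S : Type} [CommRing S] [Algebra ℂ S] (u v : ι → S),
      aeval (fun i : Fin (n + 1) => productCoeff u v i) h =
        ∑ σ : Equiv.Perm ι, bracketMonomial w (u ∘ σ) (v ∘ σ) := by
  obtain ⟨h, hh⟩ := sum_perm_aeval_mem_range (R := MvPolynomial (ι ⊕ ι) ℂ) hn
    (fun a => X (Sum.inl a)) (fun a => X (Sum.inr a)) e _ hw.isWeightedHomogeneous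
  have key : ∀ {S : Type} [CommRing S] [Algebra ℂ S] (u v : ι → S),
      aeval (fun i : Fin (n + 1) => productCoeff u v i) h =
        ∑ σ : Equiv.Perm ι, bracketMonomial w (u ∘ σ) (v ∘ σ) := by
    intro S _ _ u v
    have := congrArg (aeval (Sum.elim u v)) hh
    simpa only [AlgHom.toRingHom_eq_coe, RingHom.coe_coe, map_sum, comp_aeval_apply,
      map_productCoeff, map_bracketMonomial, aeval_X, Sum.elim_inl, Sum.elim_inr,
      Function.comp_def] using this
  refine ⟨h, fun g a => ?_, key⟩
  obtain ⟨u, v, huv⟩ := exists_productCoeff_eq hn hpos a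
  obtain rfl := funext huv
  rw [sl2Act_productCoeff hn, ← aeval_eq_eval, ← aeval_eq_eval, key, key]
  refine Finset.sum_congr rfl fun σ _ => ?_
  exact bracketMonomial_linear g.1 g.2 w (u ∘ σ) (v ∘ σ)

end BracketMonomial

/-- If all power sums of a finite family lie in `L`, its members are algebraic over `L`. -/
theorem isAlgebraic_of_psum_mem {F K ι : Type*} [Field F] [Field K] [Algebra F K] [CharZero K]
    [Fintype ι] (L : IntermediateField F K) (z : ι → K)
    (h : ∀ k : ℕ, 0 < k → ∑ i, z i ^ k ∈ L) (i : ι) : IsAlgebraic L (z i) := by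
  classical
  have hE : ∀ k, aeval z (esymm ι ℤ k) ∈ L := by
    intro k
    induction k using Nat.strong_induction_on with
    | _ k ih =>
      rcases Nat.eq_zero_or_pos k with rfl | hk
      · simp [one_mem]
      · have h1 := congrArg (aeval z) (mul_esymm_eq_sum ι ℤ k)
        have hk' : (k : K) ≠ 0 := Nat.cast_ne_zero.2 hk.ne'
        rw [map_mul, map_natCast] at h1
        rw [eq_div_of_mul_eq hk' ((mul_comm _ _).trans h1)]
        refine div_mem ?_ (natCast_mem _ _)
        simp only [map_mul, map_pow, map_neg, map_one, map_sum]
        refine mul_mem (pow_mem (neg_mem (one_mem _)) _) (sum_mem fun a ha => ?_)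
        rw [Finset.mem_filter, Finset.HasAntidiagonal.mem_antidiagonal] at ha
        refine mul_mem (mul_mem (pow_mem (neg_mem (one_mem _)) _) (ih _ ha.2)) ?_
        simp only [psum, map_sum, map_pow, aeval_X]
        exact h _ (by omega)
  let q : Polynomial L := ∑ j ∈ Finset.range (Fintype.card ι + 1),
    Polynomial.C ⟨_, hE j⟩ * Polynomial.X ^ (Fintype.card ι - j)
  have hq : q.map (algebraMap L K) = ∏ i, (Polynomial.X + Polynomial.C (z i)) := by
    have h1 := congrArg (Polynomial.map (aeval z).toRingHom)
      (MvPolynomial.prod_C_add_X_eq_sum_esymm ℤ ι)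
    simp only [Polynomial.map_prod, Polynomial.map_add, Polynomial.map_X, Polynomial.map_C,
      Polynomial.map_sum, Polynomial.map_mul, Polynomial.map_pow, AlgHom.toRingHom_eq_coe,
      RingHom.coe_coe, aeval_X] at h1
    rw [h1]
    simp [q, Polynomial.map_sum]
  have hneg : IsAlgebraic L (-z i) := by
    refine ⟨q, ?_, ?_⟩
    · intro h0
      rw [h0, Polynomial.map_zero] at hq
      exact (Polynomial.monic_prod_of_monic _ _ fun i _ => Polynomial.monic_X_add_C (z i)).ne_zero
        hq.symm
    · rw [← Polynomial.eval_map_algebraMap, hq, Polynomial.eval_prod]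
      exact Finset.prod_eq_zero (Finset.mem_univ i) (by simp)
  simpa using hneg.neg

/-- If all invariants take values in the relatively algebraically closed field `L` at a form, then
so do all regular bracket monomials in its linear factors. -/
theorem IsRegularExponent.bracketMonomial_mem {ι : Type*} [Fintype ι] [DecidableEq ι] {n : ℕ}
    (hn : Fintype.card ι = n) (hpos : 0 < n) {K : Type} [Field K] [Algebra ℂ K]
    (L : IntermediateField ℂ K) (hL : ∀ z, IsAlgebraic L z → z ∈ L) (u v : ι → K)
    (hinv : ∀ h ∈ invariantRing n, aeval (fun i : Fin (n + 1) => productCoeff u v i) h ∈ L)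
    {w : ι → ι → ℕ} {e : ℕ} (hw : IsRegularExponent w e) : bracketMonomial w u v ∈ L := by
  have : CharZero K := charZero_of_injective_algebraMap (algebraMap ℂ K).injective
  refine hL _ (isAlgebraic_of_psum_mem L
    (fun σ : Equiv.Perm ι => bracketMonomial w (u ∘ σ) (v ∘ σ)) (fun k _ => ?_) 1)
  obtain ⟨h, hh, hs⟩ := (hw.nsmul k).exists_invariant hn hpos
  simp_rw [← bracketMonomial_nsmul]
  rw [← hs]
  exact hinv h hh

theorem IsHSOP.aeval_mem {n : ℕ} {d : Fin (n - 2) → ℕ} {p : Fin (n - 2) → invariantRing n}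
    (hp : IsHSOP n d p) {K : Type} [Field K] [Algebra ℂ K] (L : IntermediateField ℂ K)
    (hL : ∀ z, IsAlgebraic L z → z ∈ L) (a : Fin (n + 1) → K)
    (ha : ∀ k, aeval a (p k : MvPolynomial (Fin (n + 1)) ℂ) ∈ L)
    {h : MvPolynomial (Fin (n + 1)) ℂ} (hh : h ∈ invariantRing n) : aeval a h ∈ L := by
  have := hp.2.2.2
  let f : invariantRing n →ₐ[ℂ] K := (aeval a).comp (invariantRing n).val
  have hf : ∀ x ∈ Algebra.adjoin ℂ (Set.range p), f x ∈ L := by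
    have : Algebra.adjoin ℂ (Set.range p) ≤ L.toSubalgebra.comap f := by
      refine Algebra.adjoin_le ?_
      rintro _ ⟨k, rfl⟩
      exact ha k
    exact this
  have hint : Algebra.IsIntegral (Algebra.adjoin ℂ (Set.range p)) (invariantRing n) :=
    Algebra.IsIntegral.of_finite _ _
  obtain ⟨q, hq, hq0⟩ := hint.isIntegral ⟨h, hh⟩
  let φ : Algebra.adjoin ℂ (Set.range p) →+* L :=
    ((f.comp (Algebra.adjoin ℂ (Set.range p)).val).codRestrict L.toSubalgebra
      (fun x => hf x x.2)).toRingHom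
  refine hL _ (IsIntegral.isAlgebraic ⟨q.map φ, hq.map φ, ?_⟩)
  rw [Polynomial.eval₂_map]
  have := congrArg f hq0
  rw [map_zero] at this
  change f.toRingHom _ = 0 at this
  rw [Polynomial.hom_eval₂] at this
  exact this

theorem MvPolynomial.IsHomogeneous.aeval_mul_left {σ R S : Type*} [CommRing R] [CommRing S]
    [Algebra R S] [Fintype σ] {h : MvPolynomial σ R} {d : ℕ} (hh : h.IsHomogeneous d) (c : S) (a : σ → S) :
    MvPolynomial.aeval (fun i => c * a i) h = c ^ d * MvPolynomial.aeval a h := by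
  rw [aeval_def, aeval_def, eval₂_eq', eval₂_eq', Finset.mul_sum]
  refine Finset.sum_congr rfl fun s hs => ?_
  have h1 : ∑ i, s i = d := by
    rw [← hh (mem_support_iff.1 hs), Finsupp.weight_apply, Finsupp.sum_fintype _ _ (by simp)]
    simp
  simp_rw [mul_pow]
  rw [Finset.prod_mul_distrib, Finset.prod_pow_eq_pow_sum, h1]
  ring

/-- If the coefficient vector is an eigenvector of `y ↦ ζ * y` with eigenvalue `ζ ^ j`, then a
homogeneous invariant that does not vanish there has degree divisible by the order of `ζ`. -/
theorem dvd_degree_of_aeval_ne_zero {ι : Type*} [Fintype ι] [DecidableEq ι] {m j t d : ℕ}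
    (hn : Fintype.card ι = 2 * m) (hj : j ≤ m) (hcop : Nat.gcd (m - j) t = 1)
    {ζ : ℂ} (hζ : IsPrimitiveRoot ζ t) (ht : t ≠ 0) {K : Type*} [Field K] [Algebra ℂ K] (u v : ι → K)
    (huv : ∀ i : Fin (2 * m + 1), algebraMap ℂ K ζ ^ (i : ℕ) * productCoeff u v i =
      algebraMap ℂ K ζ ^ j * productCoeff u v i)
    {h : MvPolynomial (Fin (2 * m + 1)) ℂ} (hh : h ∈ invariantRing (2 * m))
    (hd : h.IsHomogeneous d)
    (h0 : aeval (fun i : Fin (2 * m + 1) => productCoeff u v i) h ≠ 0) : t ∣ d := by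
  obtain ⟨η, hη⟩ := IsAlgClosed.exists_pow_nat_eq ζ (n := 2) (by norm_num)
  have hζ0 : ζ ≠ 0 := hζ.ne_zero ht
  have hη0 : η ≠ 0 := by
    rintro rfl
    exact hζ0 (by simpa using hη.symm)
  have key := aeval_productCoeff_of_mem_invariantRing hn hh
    ⟨!![η⁻¹, 0; 0, η], by simp [Matrix.det_fin_two, hη0]⟩ u v
  have e : ∀ i : Fin (2 * m + 1), productCoeff
      (fun a => u a * algebraMap ℂ K η⁻¹ + v a * algebraMap ℂ K 0)
      (fun a => u a * algebraMap ℂ K 0 + v a * algebraMap ℂ K η) i =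
      algebraMap ℂ K (ζ ^ j / ζ ^ m) * productCoeff u v i := by
    intro i
    have h1 := productCoeff_mul_left (fun _ => algebraMap ℂ K η⁻¹) u
      (fun a => algebraMap ℂ K ζ * v a) i
    rw [productCoeff_mul_right (algebraMap ℂ K ζ) u v, huv, Finset.prod_const, Finset.card_univ,
      hn, ← hη] at h1
    rw [← hη]
    convert h1 using 1
    · congr 1
      · funext a; simp [mul_comm]
      · funext a
        rw [map_zero, mul_zero, zero_add, ← mul_assoc, ← map_mul, mul_comm]
        congr 2
        field_simp
    · rw [← mul_assoc, ← map_pow, ← map_pow, ← map_mul]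
      congr 2
      rw [← pow_mul η 2 m, inv_pow]
      field_simp
  have e' : (aeval fun i : Fin (2 * m + 1) => algebraMap ℂ K (ζ ^ j / ζ ^ m) * productCoeff u v i) h
      = aeval (fun i : Fin (2 * m + 1) => productCoeff u v i) h := by
    rw [← key]
    congr 2
    funext i
    rw [← e i]
    simp
  rw [hd.aeval_mul_left] at e'
  have h2 : algebraMap ℂ K ((ζ ^ j / ζ ^ m) ^ d) = 1 := by
    rw [map_pow]
    exact mul_right_cancel₀ h0 (e'.trans (one_mul _).symm)
  have h3 : (ζ ^ j / ζ ^ m) ^ d = 1 := (algebraMap ℂ K).injective (h2.trans (map_one _).symm)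
  have h4 : ζ ^ ((m - j) * d) = 1 := by
    rw [pow_mul, ← inv_inj, inv_one, ← inv_pow, ← h3]
    congr 1
    rw [pow_sub₀ _ hζ0 hj]
    field_simp
  exact (Nat.Coprime.symm hcop).dvd_of_dvd_mul_left ((hζ.pow_eq_one_iff_dvd _).1 h4)

theorem exists_isRegularExponent {X Y Z : Type*} [Fintype X] [Fintype Y] [Fintype Z]
    (hX : Fintype.card X < Fintype.card Y + Fintype.card Z)
    (hY : Fintype.card Y < Fintype.card X + Fintype.card Z) (hZ : 0 < Fintype.card Z) :
    ∃ (w : (X ⊕ Y) ⊕ Z → (X ⊕ Y) ⊕ Z → ℕ) (e : ℕ), IsRegularExponent w e ∧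
      (∀ x x', w (Sum.inl (Sum.inl x)) (Sum.inl (Sum.inl x')) = 0) ∧
      (∀ y y', w (Sum.inl (Sum.inr y)) (Sum.inl (Sum.inr y')) = 0) ∧
      (∀ z, w (Sum.inr z) (Sum.inr z) = 0) ∧
      (∀ z z', z ≠ z' → 0 < w (Sum.inr z) (Sum.inr z')) := by
  classical
  obtain ⟨N, hN⟩ := Nat.exists_eq_add_of_lt hZ
  obtain ⟨s, hs⟩ := Nat.exists_eq_add_of_lt hX
  obtain ⟨q, hq⟩ := Nat.exists_eq_add_of_lt hY
  set x := Fintype.card X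
  set y := Fintype.card Y
  set z := Fintype.card Z
  let w : (X ⊕ Y) ⊕ Z → (X ⊕ Y) ⊕ Z → ℕ := Sum.elim
    (Sum.elim (fun _ => Sum.elim (Sum.elim 0 fun _ => 2 * z * N) fun _ => N * (q + 1))
      fun _ => Sum.elim (Sum.elim (fun _ => 2 * z * N) 0) fun _ => N * (s + 1))
    fun a => Sum.elim (Sum.elim (fun _ => N * (q + 1)) fun _ => N * (s + 1))
      fun b => if a = b then 0 else (s + 1) * (q + 1)
  refine ⟨w, 2 * (z * N * (x + y + z)), ?_, by simp [w], by simp [w], by simp [w], ?_⟩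
  · have h1 : ∀ a : Z, ∑ b, (if a = b then 0 else (s + 1) * (q + 1)) = N * ((s + 1) * (q + 1)) := by
      intro a
      rw [Finset.sum_ite, Finset.filter_ne, Finset.sum_const_zero, Finset.sum_const,
        Finset.card_erase_of_mem (Finset.mem_univ a), Finset.card_univ, zero_add, smul_eq_mul]
      congr 1
      change z - 1 = N
      omega
    have h2 : ∀ a : Z, ∑ b, (if b = a then 0 else (s + 1) * (q + 1)) = N * ((s + 1) * (q + 1)) := by
      intro a
      simp_rw [eq_comm (b := a)]
      exact h1 a
    rintro ((a | a) | a)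
    · simp only [w, Fintype.sum_sum_type, Sum.elim_inl, Sum.elim_inr, Finset.sum_add_distrib,
        Finset.sum_const, Finset.card_univ, smul_eq_mul, Pi.zero_apply]
      zify at hs hq ⊢
      linear_combination (-2 * z * N : ℤ) * hq
    · simp only [w, Fintype.sum_sum_type, Sum.elim_inl, Sum.elim_inr, Finset.sum_add_distrib,
        Finset.sum_const, Finset.card_univ, smul_eq_mul, Pi.zero_apply]
      zify at hs hq ⊢
      linear_combination (-2 * z * N : ℤ) * hs
    · simp only [w, Fintype.sum_sum_type, Sum.elim_inl, Sum.elim_inr, Finset.sum_add_distrib,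
        Finset.sum_const, Finset.card_univ, smul_eq_mul, h1, h2]
      zify at hs hq ⊢
      linear_combination (-2 * N * (q + 1 + y) : ℤ) * hs - (2 * N * (y + z) : ℤ) * hq
  · intro a b hab
    simp [w, hab]

theorem bracketMonomial_ne_zero {ι K : Type*} [Fintype ι] [Field K] {w : ι → ι → ℕ} {u v : ι → K}
    (h : ∀ a b, u a * v b - u b * v a = 0 → w a b = 0) : bracketMonomial w u v ≠ 0 := by
  refine Finset.prod_ne_zero_iff.2 fun a _ => Finset.prod_ne_zero_iff.2 fun b _ h0 => ?_
  obtain ⟨h1, h2⟩ := pow_eq_zero_iff'.1 h0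
  exact h2 (h a b h1)

theorem cross_ratio_mem {ι F K : Type*} [Fintype ι] [DecidableEq ι] [Field F] [Field K]
    [Algebra F K] (L : IntermediateField F K) {u v : ι → K}
    (hmem : ∀ (w : ι → ι → ℕ) (e : ℕ), IsRegularExponent w e → bracketMonomial w u v ∈ L)
    {w : ι → ι → ℕ} {e : ℕ} (hw : IsRegularExponent w e) (h0 : bracketMonomial w u v ≠ 0)
    {a b a' b' : ι} (haa : a ≠ a') (h1 : 0 < w a b') (h2 : 0 < w a' b) :
    ((u a * v a' - u a' * v a) * (u b * v b' - u b' * v b)) /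
      ((u a * v b' - u b' * v a) * (u a' * v b - u b * v a')) ∈ L := by
  have hle : Pi.single a (Pi.single b' 1) + Pi.single a' (Pi.single b 1) ≤ w := by
    intro i k
    rcases eq_or_ne i a with rfl | hi
    · rcases eq_or_ne k b' with rfl | hk
      · simpa [haa, Nat.one_le_iff_ne_zero] using h1.ne'
      · simp [haa, hk]
    · rcases eq_or_ne i a' with rfl | hi'
      · rcases eq_or_ne k b with rfl | hk
        · simpa [hi, Nat.one_le_iff_ne_zero] using h2.ne'
        · simp [hi, hk]
      · simp [hi, hi']
  obtain ⟨w₀, rfl⟩ := exists_add_of_le hle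
  have hw' : IsRegularExponent
      (Pi.single a (Pi.single a' 1) + Pi.single b (Pi.single b' 1) + w₀) e := by
    intro i
    have hs : ∀ x y : ι, ∑ k, ((Pi.single x (Pi.single y 1) : ι → ι → ℕ) i k +
        (Pi.single x (Pi.single y 1) : ι → ι → ℕ) k i) =
        (Pi.single x 1 : ι → ℕ) i + (Pi.single y 1 : ι → ℕ) i := by
      intro x y
      rw [Finset.sum_add_distrib]
      congr 1
      · rcases eq_or_ne i x with rfl | hi
        · simp
        · simp [hi]
      · rw [Finset.sum_eq_single x]
        · simp
        · intro k _ hk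
          simp [hk]
        · simp
    have e1 := hw i
    simp only [Pi.add_apply, Finset.sum_add_distrib] at e1 hs ⊢
    have := hs a b'
    have := hs a' b
    have := hs a a'
    have := hs b b'
    omega
  rw [bracketMonomial_add, bracketMonomial_add, bracketMonomial_single, bracketMonomial_single] at h0
  have m1 := hmem _ _ hw
  have m2 := hmem _ _ hw'
  rw [bracketMonomial_add, bracketMonomial_add, bracketMonomial_single, bracketMonomial_single]
    at m1 m2
  rw [← mul_div_mul_right _ _ (right_ne_zero_of_mul h0)]
  exact div_mem m2 m1

theorem isAlgebraic_of_quadratic {F K : Type*} [Field F] [Field K] [Algebra F K]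
    (L : IntermediateField F K) {a b c z : K} (ha : a ∈ L) (hb : b ∈ L) (hc : c ∈ L) (ha0 : a ≠ 0)
    (h : a * z ^ 2 + b * z + c = 0) : IsAlgebraic L z := by
  refine ⟨Polynomial.C ⟨a, ha⟩ * Polynomial.X ^ 2 + Polynomial.C ⟨b, hb⟩ * Polynomial.X +
    Polynomial.C ⟨c, hc⟩, ?_, ?_⟩
  · refine Polynomial.ne_zero_of_degree_gt (n := 1) ?_
    rw [Polynomial.degree_quadratic]
    · norm_num
    · intro h0
      exact ha0 (congrArg Subtype.val h0)
  · simpa using h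

theorem FractionRing.intermediateField_eq_top {σ F : Type*} [Field F]
    (L : IntermediateField F (FractionRing (MvPolynomial σ F)))
    (hL : ∀ i, algebraMap (MvPolynomial σ F) (FractionRing (MvPolynomial σ F)) (X i) ∈ L) :
    L = ⊤ := by
  have h1 : ∀ q : MvPolynomial σ F, algebraMap _ (FractionRing (MvPolynomial σ F)) q ∈ L := by
    intro q
    induction q using MvPolynomial.induction_on with
    | C a =>
      rw [← MvPolynomial.algebraMap_eq, ← IsScalarTower.algebraMap_apply]
      exact L.algebraMap_mem a
    | add p q hp hq => rw [map_add]; exact add_mem hp hq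
    | mul_X p i hp => rw [map_mul]; exact mul_mem hp (hL i)
  refine eq_top_iff.2 fun z _ => ?_
  obtain ⟨p, q, _, rfl⟩ := IsFractionRing.div_surjective (A := MvPolynomial σ F) z
  exact div_mem (h1 p) (h1 q)

section Configuration

variable {K : Type*} [Field K] [Algebra ℂ K] {j r k t : ℕ}

/-- The first coordinates of the points of the configuration: `j` points `(0, c)`, `r` points
`(c, 0)` and the points `(c, c * ξ * l i)` for `i : Fin k` and `ξ` a root of unity. -/
def configFst (j r k t : ℕ) (c : K) : (Fin j ⊕ Fin r) ⊕ (Fin k × rootsOfUnity t ℂ) → K :=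
  Sum.elim (Sum.elim (fun _ => 0) fun _ => c) fun _ => c

/-- The second coordinates of the points of the configuration: `j` points `(0, c)`, `r` points
`(c, 0)` and the points `(c, c * ξ * l i)` for `i : Fin k` and `ξ` a root of unity. -/
def configSnd (j r k t : ℕ) (c : K) (l : Fin k → K) :
    (Fin j ⊕ Fin r) ⊕ (Fin k × rootsOfUnity t ℂ) → K :=
  Sum.elim (Sum.elim (fun _ => c) fun _ => 0)
    fun z => c * (algebraMap ℂ K ((z.2 : ℂˣ) : ℂ) * l z.1)

variable [NeZero t] [Fintype (rootsOfUnity t ℂ)]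

theorem card_config :
    Fintype.card ((Fin j ⊕ Fin r) ⊕ (Fin k × rootsOfUnity t ℂ)) = j + r + k * t := by
  simp_rw [Fintype.card_sum, Fintype.card_prod, Fintype.card_fin,
    Fintype.card_eq_nat_card (α := rootsOfUnity t ℂ), Complex.card_rootsOfUnity]

theorem algebraMap_pow_mul_productCoeff_config {n : ℕ} (hn : j + r + k * t = n)
    {ζ : ℂ} (hζ : IsPrimitiveRoot ζ t) (c : K) (l : Fin k → K) (i : Fin (n + 1)) :
    algebraMap ℂ K ζ ^ (i : ℕ) * productCoeff (configFst j r k t c) (configSnd j r k t c l) i =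
      algebraMap ℂ K ζ ^ j * productCoeff (configFst j r k t c) (configSnd j r k t c l) i := by
  have hcard : Fintype.card ((Fin j ⊕ Fin r) ⊕ (Fin k × rootsOfUnity t ℂ)) = n := by
    rw [card_config, hn]
  let ξ : rootsOfUnity t ℂ := hζ.toRootsOfUnity
  let σ : Equiv.Perm ((Fin j ⊕ Fin r) ⊕ (Fin k × rootsOfUnity t ℂ)) :=
    Equiv.sumCongr (Equiv.refl _) (Equiv.prodCongr (Equiv.refl _) (Equiv.mulLeft ξ))
  let s : (Fin j ⊕ Fin r) ⊕ (Fin k × rootsOfUnity t ℂ) → K :=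
    Sum.elim (Sum.elim (fun _ => algebraMap ℂ K ζ) fun _ => 1) fun _ => 1
  rw [← productCoeff_mul_right, ← productCoeff_comp_perm hcard σ (configFst j r k t c)
    (configSnd j r k t c l)]
  have hs : ∏ a, s a = algebraMap ℂ K ζ ^ j := by simp [s, Fintype.prod_sum_type]
  rw [← hs, ← productCoeff_mul_left]
  congr 1
  · funext a
    rcases a with (a | a) | a <;> simp [s, σ, configFst]
  · funext a
    rcases a with (a | a) | a
    · simp [s, σ, configSnd]
    · simp [s, σ, configSnd]
    · simp [s, σ, configSnd, ξ]
      ring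

/-- If all regular bracket monomials of the configuration and one `l i₀` lie in the relatively
algebraically closed field `L`, then so do all parameters of the configuration. -/
theorem configuration_mem (ht : 1 < t) (hj : j < r + k * t) (hr : r < j + k * t)
    {l : Fin k → K} {c : K} (hc : c ≠ 0)
    (hl : ∀ z z' : Fin k × rootsOfUnity t ℂ,
      algebraMap ℂ K ((z.2 : ℂˣ) : ℂ) * l z.1 = algebraMap ℂ K ((z'.2 : ℂˣ) : ℂ) * l z'.1 → z = z')
    (hl0 : ∀ i, l i ≠ 0) (L : IntermediateField ℂ K) (hL : ∀ z, IsAlgebraic L z → z ∈ L)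
    (i₀ : Fin k) (hi₀ : l i₀ ∈ L)
    (hmem : ∀ w e, IsRegularExponent w e →
      bracketMonomial w (configFst j r k t c) (configSnd j r k t c l) ∈ L) :
    c ∈ L ∧ ∀ i, l i ∈ L := by
  classical
  obtain ⟨ζ, hζ⟩ : ∃ ζ : ℂ, IsPrimitiveRoot ζ t := ⟨_, Complex.isPrimitiveRoot_exp t (NeZero.ne t)⟩
  have hcard : Fintype.card (Fin k × rootsOfUnity t ℂ) = k * t := by
    rw [Fintype.card_prod, Fintype.card_fin, Fintype.card_eq_nat_card, Complex.card_rootsOfUnity]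
  let ξ : rootsOfUnity t ℂ := hζ.toRootsOfUnity
  have hξ : ((ξ : ℂˣ) : ℂ) = ζ := rfl
  have hζ1 : ζ ≠ 1 := hζ.ne_one ht
  have hξ1 : ξ ≠ 1 := by
    intro h
    rw [h] at hξ
    exact hζ1 (by simpa using hξ.symm)
  have hk : 0 < k := i₀.pos
  have hroot : ∀ ξ : rootsOfUnity t ℂ, algebraMap ℂ K ((ξ : ℂˣ) : ℂ) ≠ 0 := by
    intro ξ
    simp
  obtain ⟨w, e, hw, hXX, hYY, hZZ, hZ⟩ := exists_isRegularExponent (X := Fin j) (Y := Fin r)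
    (Z := Fin k × rootsOfUnity t ℂ) (by simpa [hcard] using hj) (by simpa [hcard] using hr)
    (by rw [hcard]; positivity)
  have hne : ∀ c : K, c ≠ 0 →
      bracketMonomial w (configFst j r k t c) (configSnd j r k t c l) ≠ 0 := by
    intro c hc
    refine bracketMonomial_ne_zero ?_
    rintro ((a | a) | a) ((b | b) | b) h
    · exact hXX _ _
    · simp [configFst, configSnd, hc] at h
    · simp [configFst, configSnd, hc] at h
    · simp [configFst, configSnd, hc] at h
    · exact hYY _ _
    · simp [configFst, configSnd, hc, hl0] at h
    · simp [configFst, configSnd, hc] at h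
    · simp [configFst, configSnd, hc, hl0] at h
    · have : a = b := by
        refine hl a b ?_
        simp only [configFst, configSnd, Sum.elim_inr] at h
        have h2 : c ^ 2 ≠ 0 := pow_ne_zero 2 hc
        refine mul_left_cancel₀ h2 ?_
        linear_combination -h
      rw [this]
      exact hZZ b
  have hlL : ∀ i, l i ∈ L := by
    intro i
    rcases eq_or_ne i i₀ with rfl | hi
    · exact hi₀
    have hζK : algebraMap ℂ K ζ - 1 ≠ 0 := by
      rw [← map_one (algebraMap ℂ K), ← map_sub]
      simpa [sub_eq_zero] using hζ1
    have h1 := hl (i, ξ) (i₀, 1)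
    have h2 := hl (i, 1) (i₀, ξ)
    have hq := cross_ratio_mem L hmem hw (hne c hc) (a := Sum.inr (i₀, 1)) (a' := Sum.inr (i₀, ξ))
      (b := Sum.inr (i, 1)) (b' := Sum.inr (i, ξ)) (by simpa using hξ1.symm)
      (hZ _ _ (by simp [hi.symm])) (hZ _ _ (by simp [hi.symm]))
    simp only [hξ, Subgroup.coe_one, Units.val_one, map_one, one_mul, Prod.mk.injEq, hi, false_and,
      imp_false, configFst, configSnd, Sum.elim_inr] at h1 h2 hq
    set z := algebraMap ℂ K ζ
    generalize hqdef : (_ / _ : K) = q at hq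
    have hzL : z ∈ L := L.algebraMap_mem ζ
    have h1' : z * l i - l i₀ ≠ 0 := sub_ne_zero.2 h1
    have h2' : l i - z * l i₀ ≠ 0 := sub_ne_zero.2 h2
    have hqe : q = ((z - 1) ^ 2 * l i₀ * l i) / ((z * l i - l i₀) * (l i - z * l i₀)) := by
      rw [← hqdef, div_eq_div_iff]
      · ring
      · have : (c * (c * (z * l i)) - c * (c * l i₀)) * (c * (c * l i) - c * (c * (z * l i₀))) =
          c ^ 4 * ((z * l i - l i₀) * (l i - z * l i₀)) := by ring
        rw [this]
        exact mul_ne_zero (pow_ne_zero 4 hc) (mul_ne_zero h1' h2')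
      · exact mul_ne_zero h1' h2'
    have hq0 : q ≠ 0 := by
      rw [hqe]
      exact div_ne_zero (mul_ne_zero (mul_ne_zero (pow_ne_zero 2 hζK) (hl0 _)) (hl0 _))
        (mul_ne_zero h1' h2')
    have hz0 : z ≠ 0 := hroot ξ
    rw [eq_div_iff (mul_ne_zero h1' h2')] at hqe
    refine hL _ (isAlgebraic_of_quadratic L (a := q * z)
      (b := -(q * (z ^ 2 + 1) + (z - 1) ^ 2) * l i₀) (c := q * z * l i₀ ^ 2)
      (mul_mem hq hzL) (mul_mem (neg_mem (add_mem (mul_mem hq (add_mem (pow_mem hzL 2)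
        (one_mem _))) (pow_mem (sub_mem hzL (one_mem _)) 2))) hi₀)
      (mul_mem (mul_mem hq hzL) (pow_mem hi₀ 2)) (mul_ne_zero hq0 hz0) ?_)
    linear_combination hqe
  refine ⟨?_, hlL⟩
  have hscale : bracketMonomial w (configFst j r k t c) (configSnd j r k t c l) =
      c ^ (2 * ∑ a, ∑ b, w a b) *
        bracketMonomial w (configFst j r k t 1) (configSnd j r k t 1 l) := by
    rw [← bracketMonomial_mul_left]
    congr 1
    · funext a
      rcases a with (a | a) | a <;> simp [configFst]
    · funext a
      rcases a with (a | a) | a <;> simp [configSnd]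
  have hbase : bracketMonomial w (configFst j r k t 1) (configSnd j r k t 1 l) ∈ L := by
    refine prod_mem fun a _ => prod_mem fun b _ => pow_mem (sub_mem (mul_mem ?_ ?_)
      (mul_mem ?_ ?_)) _
    all_goals
      first
      | rcases a with (a | a) | a <;> simp [configFst, configSnd, zero_mem, one_mem]
        <;> exact mul_mem (L.algebraMap_mem _) (hlL _)
      | rcases b with (b | b) | b <;> simp [configFst, configSnd, zero_mem, one_mem]
        <;> exact mul_mem (L.algebraMap_mem _) (hlL _)
  have hpos : 0 < 2 * ∑ a, ∑ b, w a b := by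
    have := hZ (i₀, 1) (i₀, ξ) (by simpa using hξ1.symm)
    refine Nat.mul_pos two_pos (this.trans_le ?_)
    refine le_trans ?_ (Finset.single_le_sum (fun _ _ => Nat.zero_le _)
      (Finset.mem_univ (Sum.inr (i₀, (1 : rootsOfUnity t ℂ)))))
    exact Finset.single_le_sum (f := fun b => w (Sum.inr (i₀, 1)) b) (fun _ _ => Nat.zero_le _)
      (Finset.mem_univ _)
  have hpow : c ^ (2 * ∑ a, ∑ b, w a b) ∈ L := by
    have h1 := hmem w e hw
    rw [hscale] at h1
    have := div_mem h1 hbase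
    rwa [mul_div_cancel_right₀ _ (hne 1 one_ne_zero)] at this
  refine hL _ (IsAlgebraic.of_pow hpos ?_)
  exact isAlgebraic_algebraMap (⟨_, hpow⟩ : L)

end Configuration

theorem le_card_filter_dvd_degree {m j r k t : ℕ} [NeZero t] (ht : 1 < t) (hk : 0 < k)
    (hcard : j + r + k * t = 2 * m) (hj : j < m) (hr : r < m) (hcop : Nat.gcd (m - j) t = 1)
    (d : Fin (2 * m - 2) → ℕ) (p : Fin (2 * m - 2) → invariantRing (2 * m))
    (hp : IsHSOP (2 * m) d p) : k ≤ (Finset.univ.filter fun i => t ∣ d i).card := by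
  classical
  have : Fintype (rootsOfUnity t ℂ) := Fintype.ofFinite _
  obtain ⟨ζ, hζ⟩ : ∃ ζ : ℂ, IsPrimitiveRoot ζ t := ⟨_, Complex.isPrimitiveRoot_exp t (NeZero.ne t)⟩
  have hcard' : Fintype.card ((Fin j ⊕ Fin r) ⊕ (Fin k × rootsOfUnity t ℂ)) = 2 * m := by
    rw [card_config, hcard]
  let A := MvPolynomial (Option (Fin k)) ℂ
  let K := FractionRing A
  let c : K := algebraMap A K (X none)
  let l : Fin k → K := fun i => algebraMap A K (X (some i))
  let i₀ : Fin k := ⟨0, hk⟩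
  have hinj : Function.Injective (algebraMap A K) := IsFractionRing.injective A K
  have hl0 : ∀ i, l i ≠ 0 := fun i => (map_ne_zero_iff _ hinj).2 (X_ne_zero _)
  have hc : c ≠ 0 := (map_ne_zero_iff _ hinj).2 (X_ne_zero _)
  have hl : ∀ z z' : Fin k × rootsOfUnity t ℂ,
      algebraMap ℂ K ((z.2 : ℂˣ) : ℂ) * l z.1 = algebraMap ℂ K ((z'.2 : ℂˣ) : ℂ) * l z'.1 →
        z = z' := by
    rintro ⟨i, ξ⟩ ⟨i', ξ'⟩ h
    rw [IsScalarTower.algebraMap_apply ℂ A K, IsScalarTower.algebraMap_apply ℂ A K, ← map_mul,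
      ← map_mul] at h
    have h1 : eval (Pi.single (some i) 1) (C ((ξ : ℂˣ) : ℂ) * X (some i)) =
        eval (Pi.single (some i) 1) (C ((ξ' : ℂˣ) : ℂ) * X (some i')) :=
      congrArg (eval (Pi.single (some i) 1)) (hinj h)
    rcases eq_or_ne i i' with rfl | hi
    · simpa [Units.val_inj] using h1
    · simp [hi.symm] at h1
  let u := configFst j r k t c
  let v := configSnd j r k t c l
  let a : Fin (2 * m + 1) → K := fun i => productCoeff u v i
  let ev : Fin (2 * m - 2) → K := fun i => aeval a (p i : MvPolynomial (Fin (2 * m + 1)) ℂ)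
  let S := Finset.univ.filter fun i => t ∣ d i
  let T : Finset K := insert (l i₀) (S.image ev)
  let E : IntermediateField ℂ K := IntermediateField.adjoin ℂ T
  let L : IntermediateField ℂ K := (algebraicClosure E K).restrictScalars ℂ
  have hEL : ∀ z ∈ E, z ∈ L := fun z hz => (algebraicClosure E K).algebraMap_mem ⟨z, hz⟩
  have hL : ∀ z, IsAlgebraic L z → z ∈ L := by
    intro z hz
    have hz' : IsAlgebraic (algebraicClosure E K) z := hz
    exact mem_algebraicClosure_iff.2 (hz'.restrictScalars E)
  have hev : ∀ i, ev i ∈ L := by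
    intro i
    by_cases hi : t ∣ d i
    · refine hEL _ (IntermediateField.subset_adjoin ℂ _ ?_)
      simp only [T, Finset.coe_insert, Finset.coe_image]
      exact Or.inr ⟨i, by simpa [S] using hi, rfl⟩
    · have : ev i = 0 := by
        by_contra h0
        exact hi (dvd_degree_of_aeval_ne_zero hcard' hj.le hcop hζ (NeZero.ne t) u v
          (algebraMap_pow_mul_productCoeff_config hcard hζ c l) (p i).2 (hp.2.1 i) h0)
      rw [this]
      exact zero_mem _
  have hmem : ∀ w e, IsRegularExponent w e → bracketMonomial w u v ∈ L := fun w e hw =>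
    hw.bracketMonomial_mem hcard' (by omega) L hL u v fun h hh => hp.aeval_mem L hL a hev hh
  obtain ⟨hcL, hlL⟩ := configuration_mem ht (by omega) (by omega) hc hl hl0 L hL i₀
    (hEL _ (IntermediateField.subset_adjoin ℂ _ (by simp [T]))) hmem
  have htop : L = ⊤ := FractionRing.intermediateField_eq_top L (by
    rintro (_ | i)
    · exact hcL
    · exact hlL i)
  have halg : Algebra.IsAlgebraic E K := by
    refine ⟨fun z => mem_algebraicClosure_iff.1 ?_⟩
    change z ∈ L
    rw [htop]
    trivial
  have halg' : Algebra.IsAlgebraic (Algebra.adjoin ℂ (T : Set K)) K :=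
    IntermediateField.isAlgebraic_adjoin_iff_top.1 halg
  have h1 := Algebra.IsAlgebraic.trdeg_le_cardinalMk ℂ (T : Set K)
  have hind : AlgebraicIndependent ℂ (fun i : Option (Fin k) => algebraMap A K (X i)) :=
    (MvPolynomial.algebraicIndependent_X (Option (Fin k)) ℂ).map'
      (f := IsScalarTower.toAlgHom ℂ A K) hinj
  have h2 := hind.cardinalMk_le_trdeg.trans h1
  have h3 : k + 1 ≤ T.card := by
    simpa using h2
  have h4 : T.card ≤ S.card + 1 := (Finset.card_insert_le (l i₀) (S.image ev)).trans
    (Nat.succ_le_succ Finset.card_image_le)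
  change k ≤ S.card
  omega

theorem stmt_3 (n : ℕ) (hn : 4 ≤ n) (heven : Even n) (t : ℕ) (ht : 1 < t)
    (j : ℕ) (hjn : j ≤ n / 2) (hcop : Nat.gcd (n / 2 - j) t = 1)
    (hmin : ∀ j' : ℕ, j' < j → Nat.gcd (n / 2 - j') t ≠ 1)
    (d : Fin (n-2) → ℕ) (p : Fin (n-2) → invariantRing n) (hp : IsHSOP n d p) :
    (n - j) / t ≤ (Finset.univ.filter fun k => t ∣ d k).card := by
  obtain ⟨m, rfl⟩ := even_iff_two_dvd.1 heven
  have hm : 2 * m / 2 = m := by omega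
  rw [hm] at hjn hcop
  have hne : NeZero t := ⟨by omega⟩
  have hj : j < m := by
    refine lt_of_le_of_ne hjn fun h => ?_
    rw [h, Nat.sub_self, Nat.gcd_zero_left] at hcop
    omega
  rcases Nat.eq_zero_or_pos ((2 * m - j) / t) with hk | hk
  · rw [hk]
    exact Nat.zero_le _
  · have h1 := Nat.div_add_mod' (2 * m - j) t
    have h2 := Nat.mod_lt (2 * m - j) (Nat.zero_lt_of_lt ht)
    have h3 := Nat.le_mul_of_pos_left t hk
    exact le_card_filter_dvd_degree (r := (2 * m - j) % t) ht hk (by omega) hj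
      (by omega) hcop d p hp
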